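/- Let H ∈ (1/2, 1), T > 0, and let f : [0, T] → ℝ be bounded with |f(t) − f(s)| ≤ K·|t − s|^{α₀} for all s, t ∈ [0, T], for some K ≥ 0 and α₀ ∈ (H − 1/2, 1]. Let v : [0, T] → ℝ be bounded with |v(t) − v(s)| ≤ M·|t − s|^{1/2} for all s, t ∈ [0, T], for some M ≥ 0. Set φ = f·v and for u ∈ (0, T] define G(u) = u^{1/2−H}·φ(u) + (H − 1/2)·u^{H−1/2}·∫_0^u (u^{1/2−H}·φ(u) − s^{1/2−H}·φ(s))·(u−s)^{−(H+1/2)} ds. Then for every u ∈ (0, T] the inner integrand is Lebesgue integrable on (0, u), and ∫_0^T G(u)² du < ∞. -/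

import Mathlib

open MeasureTheory

theorem aux_J1 (u p : ℝ) (hu : 0 < u) (hp : -1 < p) :
    IntegrableOn (fun s : ℝ => s ^ p) (Set.Ioo 0 u) ∧
    ∫ s in Set.Ioo (0:ℝ) u, s ^ p = u ^ (p + 1) / (p + 1) := by
  constructor
  · have := intervalIntegral.intervalIntegrable_rpow' (a := 0) (b := u) hp
    rw [intervalIntegrable_iff_integrableOn_Ioo_of_le hu.le] at this
    exact this
  · rw [← integral_Ioc_eq_integral_Ioo, ← intervalIntegral.integral_of_le hu.le,
      integral_rpow (Or.inl hp), Real.zero_rpow (by linarith), sub_zero]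

theorem aux_J2 (u p : ℝ) (hu : 0 < u) (hp : -1 < p) :
    IntegrableOn (fun s : ℝ => (u - s) ^ p) (Set.Ioo 0 u) ∧
    ∫ s in Set.Ioo (0:ℝ) u, (u - s) ^ p = u ^ (p + 1) / (p + 1) := by
  constructor
  · have := (intervalIntegral.intervalIntegrable_rpow' (a := 0) (b := u) hp).comp_sub_left u
    simp only [sub_zero, sub_self] at this
    have := this.symm
    rw [intervalIntegrable_iff_integrableOn_Ioo_of_le hu.le] at this
    exact this
  · rw [← integral_Ioc_eq_integral_Ioo, ← intervalIntegral.integral_of_le hu.le,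
      intervalIntegral.integral_comp_sub_left (fun s => s ^ p) u, sub_zero, sub_self,
      integral_rpow (Or.inl hp), Real.zero_rpow (by linarith), sub_zero]

/-- pointwise bound of the integrand -/
theorem aux_pt (a β L B u s : ℝ) (x y : ℝ) (ha : 0 < a) (hβ : a < β) (hβ2 : β ≤ 1 / 2)
    (hL : 0 ≤ L) (hB : |x| ≤ B) (hs : 0 < s) (hsu : s < u)
    (hxy : |x - y| ≤ L * (u - s) ^ β) :
    |(u ^ (-a) * x - s ^ (-a) * y) * (u - s) ^ (-(1 + a))| ≤
      (L + B * u ^ (-β)) * ((u / 2) ^ (β - a - 1) * s ^ (-a) +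
        (u / 2) ^ (-a) * (u - s) ^ (β - a - 1)) := by
  have hu : 0 < u := hs.trans hsu
  have hd : 0 < u - s := sub_pos.2 hsu
  have hB0 : 0 ≤ B := (abs_nonneg _).trans hB
  have e0 : (u - s) ^ (β - a - 1) = (u - s) ^ β * (u - s) ^ (-(1 + a)) := by
    rw [← Real.rpow_add hd]; congr 1; ring
  have h1 : s ^ (-a) - u ^ (-a) ≤ s ^ (-a) * (u ^ (-β) * (u - s) ^ β) := by
    have hr0 : 0 < s / u := div_pos hs hu
    have hr1 : s / u ≤ 1 := (div_le_one hu).2 hsu.le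
    have t1 : s / u ≤ (s / u) ^ a := by
      simpa using Real.rpow_le_rpow_of_exponent_ge hr0 hr1 (show a ≤ 1 by linarith)
    have hq0 : 0 < (u - s) / u := div_pos hd hu
    have hq1 : (u - s) / u ≤ 1 := (div_le_one hu).2 (by linarith)
    have t2 : (u - s) / u ≤ ((u - s) / u) ^ β := by
      simpa using Real.rpow_le_rpow_of_exponent_ge hq0 hq1 (show β ≤ 1 by linarith)
    have t3 : ((u - s) / u) ^ β = u ^ (-β) * (u - s) ^ β := by
      rw [Real.div_rpow hd.le hu.le, Real.rpow_neg hu.le]; ring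
    have t4 : u ^ (-a) = s ^ (-a) * (s / u) ^ a := by
      rw [Real.div_rpow hs.le hu.le, Real.rpow_neg hu.le, Real.rpow_neg hs.le]
      have := (Real.rpow_pos_of_pos hs a).ne'
      field_simp
    have t5 : (u - s) / u = 1 - s / u := by field_simp
    have : s ^ (-a) - u ^ (-a) = s ^ (-a) * (1 - (s / u) ^ a) := by rw [t4]; ring
    rw [this, ← t3]
    exact mul_le_mul_of_nonneg_left (by linarith) (Real.rpow_nonneg hs.le _)
  have h1' : 0 ≤ s ^ (-a) - u ^ (-a) :=
    sub_nonneg.2 (Real.rpow_le_rpow_of_nonpos hs hsu.le (by linarith))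
  have hsa : 0 < s ^ (-a) := Real.rpow_pos_of_pos hs _
  have hdb : 0 < (u - s) ^ β := Real.rpow_pos_of_pos hd _
  have hdm : 0 < (u - s) ^ (-(1 + a)) := Real.rpow_pos_of_pos hd _
  have hub : 0 < u ^ (-β) := Real.rpow_pos_of_pos hu _
  have h2 : |u ^ (-a) * x - s ^ (-a) * y| ≤ (L + B * u ^ (-β)) * (s ^ (-a) * (u - s) ^ β) := by
    have e : u ^ (-a) * x - s ^ (-a) * y
        = s ^ (-a) * (x - y) - (s ^ (-a) - u ^ (-a)) * x := by ring
    rw [e]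
    refine (abs_sub _ _).trans ?_
    rw [abs_mul, abs_mul, abs_of_pos hsa, abs_of_nonneg h1']
    have i1 := mul_le_mul_of_nonneg_left hxy hsa.le
    have i2 := mul_le_mul h1 hB (abs_nonneg _) (by positivity)
    linarith
  have h3 : s ^ (-a) * (u - s) ^ (β - a - 1) ≤ (u / 2) ^ (β - a - 1) * s ^ (-a) +
        (u / 2) ^ (-a) * (u - s) ^ (β - a - 1) := by
    have hd' : 0 < (u - s) ^ (β - a - 1) := Real.rpow_pos_of_pos hd _
    have hu1 : 0 < (u / 2) ^ (β - a - 1) := Real.rpow_pos_of_pos (by linarith) _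
    have hu2 : 0 < (u / 2) ^ (-a) := Real.rpow_pos_of_pos (by linarith) _
    rcases le_total s (u / 2) with h | h
    · have : (u - s) ^ (β - a - 1) ≤ (u / 2) ^ (β - a - 1) :=
        Real.rpow_le_rpow_of_nonpos (by linarith) (by linarith) (by linarith)
      have := mul_le_mul_of_nonneg_left this hsa.le
      have := mul_pos hu2 hd'
      linarith
    · have : s ^ (-a) ≤ (u / 2) ^ (-a) :=
        Real.rpow_le_rpow_of_nonpos (by linarith) (by linarith) (by linarith)
      have := mul_le_mul_of_nonneg_right this hd'.le
      have := mul_pos hu1 hsa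
      linarith
  rw [abs_mul, abs_of_pos hdm]
  calc _ ≤ (L + B * u ^ (-β)) * (s ^ (-a) * (u - s) ^ β) * (u - s) ^ (-(1 + a)) :=
        mul_le_mul_of_nonneg_right h2 hdm.le
    _ = (L + B * u ^ (-β)) * (s ^ (-a) * (u - s) ^ (β - a - 1)) := by rw [e0]; ring
    _ ≤ _ := mul_le_mul_of_nonneg_left h3 (by positivity)

theorem aux_int (a β u : ℝ) (ha : 0 < a) (hβ : a < β) (hβ2 : β ≤ 1 / 2) (hu : 0 < u) :
    IntegrableOn (fun s : ℝ => (u / 2) ^ (β - a - 1) * s ^ (-a) +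
        (u / 2) ^ (-a) * (u - s) ^ (β - a - 1)) (Set.Ioo 0 u) ∧
    ∫ s in Set.Ioo (0:ℝ) u, ((u / 2) ^ (β - a - 1) * s ^ (-a) +
        (u / 2) ^ (-a) * (u - s) ^ (β - a - 1)) =
      ((1 / 2) ^ (β - a - 1) / (1 - a) + (1 / 2) ^ (-a) / (β - a)) * u ^ (β - 2 * a) := by
  obtain ⟨i1, e1⟩ := aux_J1 u (-a) hu (by linarith)
  obtain ⟨i2, e2⟩ := aux_J2 u (β - a - 1) hu (by linarith)
  have i1' := i1.const_mul ((u / 2) ^ (β - a - 1))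
  have i2' := i2.const_mul ((u / 2) ^ (-a))
  refine ⟨i1'.add i2', ?_⟩
  rw [integral_add i1' i2', integral_const_mul, integral_const_mul, e1, e2]
  have hh (p : ℝ) : (u / 2) ^ p = (1 / 2) ^ p * u ^ p := by
    rw [← Real.mul_rpow (by norm_num) hu.le]; congr 1; ring
  rw [hh, hh]
  have f1 : u ^ (β - 2 * a) = u ^ (β - a - 1) * u ^ (-a + 1) := by
    rw [← Real.rpow_add hu]; congr 1; ring
  have f2 : u ^ (β - 2 * a) = u ^ (-a) * u ^ (β - a - 1 + 1) := by
    rw [← Real.rpow_add hu]; congr 1; ring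
  rw [add_mul]
  nth_rewrite 1 [f1]
  rw [f2, show -a + 1 = 1 - a by ring, show β - a - 1 + 1 = β - a by ring]
  ring

theorem aux_main (a β T L B : ℝ) (ha : 0 < a) (hβ : a < β) (hβ2 : β ≤ 1 / 2)
    (ha2 : a < 1 / 2) (hT : 0 < T) (hL : 0 ≤ L) (φ G : ℝ → ℝ)
    (hB : ∀ t ∈ Set.Icc (0:ℝ) T, |φ t| ≤ B)
    (hφ : ∀ s ∈ Set.Icc (0:ℝ) T, ∀ t ∈ Set.Icc (0:ℝ) T, |φ t - φ s| ≤ L * |t - s| ^ β)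
    (hG : ∀ u ∈ Set.Ioc (0:ℝ) T,
      G u = u ^ (-a) * φ u + a * u ^ a *
        ∫ s in Set.Ioo (0:ℝ) u,
          (u ^ (-a) * φ u - s ^ (-a) * φ s) * (u - s) ^ (-(1 + a))) :
    (∀ u ∈ Set.Ioc (0:ℝ) T,
      IntegrableOn
        (fun s : ℝ => (u ^ (-a) * φ u - s ^ (-a) * φ s) * (u - s) ^ (-(1 + a)))
        (Set.Ioo 0 u)) ∧
    (∫⁻ u in Set.Ioo (0:ℝ) T, ENNReal.ofReal ((G u) ^ 2)) < ⊤ := by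
  have hB0 : 0 ≤ B := (abs_nonneg _).trans (hB 0 ⟨le_rfl, hT.le⟩)
  have hcont : ContinuousOn φ (Set.Icc 0 T) := by
    have : HolderOnWith (Real.toNNReal L) (Real.toNNReal β) φ (Set.Icc 0 T) := by
      intro s hs t ht
      rw [edist_dist, edist_dist, Real.dist_eq, Real.dist_eq,
        ENNReal.ofReal_rpow_of_nonneg (abs_nonneg _) (NNReal.coe_nonneg _),
        Real.coe_toNNReal _ (by linarith : (0:ℝ) ≤ β)]
      change _ ≤ ENNReal.ofReal L * _
      rw [← ENNReal.ofReal_mul hL]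
      exact ENNReal.ofReal_le_ofReal (hφ t ht s hs)
    exact this.continuousOn (Real.toNNReal_pos.2 (by linarith))
  have hpt : ∀ u ∈ Set.Ioc (0:ℝ) T, ∀ s ∈ Set.Ioo (0:ℝ) u,
      ‖(u ^ (-a) * φ u - s ^ (-a) * φ s) * (u - s) ^ (-(1 + a))‖ ≤
      (L + B * u ^ (-β)) * ((u / 2) ^ (β - a - 1) * s ^ (-a) +
        (u / 2) ^ (-a) * (u - s) ^ (β - a - 1)) := by
    intro u hu s hs
    refine aux_pt a β L B u s _ _ ha hβ hβ2 hL (hB u ⟨hu.1.le, hu.2⟩) hs.1 hs.2 ?_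
    have := hφ s ⟨hs.1.le, hs.2.le.trans hu.2⟩ u ⟨hu.1.le, hu.2⟩
    rwa [abs_of_pos (sub_pos.2 hs.2)] at this
  constructor
  · intro u hu
    refine Integrable.mono' ((aux_int a β u ha hβ hβ2 hu.1).1.const_mul (L + B * u ^ (-β))) ?_ ?_
    · refine ContinuousOn.aestronglyMeasurable ?_ measurableSet_Ioo
      refine ContinuousOn.mul (ContinuousOn.sub continuousOn_const (ContinuousOn.mul ?_ ?_)) ?_
      · exact continuousOn_id.rpow_const (fun x hx => Or.inl hx.1.ne')
      · exact hcont.mono fun x hx => ⟨hx.1.le, hx.2.le.trans hu.2⟩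
      · exact (continuousOn_const.sub continuousOn_id).rpow_const
          (fun x hx => Or.inl (sub_pos.2 hx.2).ne')
    · exact (ae_restrict_iff' measurableSet_Ioo).2 (Filter.Eventually.of_forall (hpt u hu))
  · set C := (1 / 2 : ℝ) ^ (β - a - 1) / (1 - a) + (1 / 2 : ℝ) ^ (-a) / (β - a) with hC
    have hC0 : 0 ≤ C := by
      have : 0 < 1 - a := by linarith
      have : 0 < β - a := by linarith
      positivity
    set D := B + a * C * (L * T ^ β + B) with hD
    have hbound : ∀ u ∈ Set.Ioo (0:ℝ) T, ENNReal.ofReal ((G u) ^ 2) ≤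
        ENNReal.ofReal (D ^ 2 * u ^ (-2 * a)) := by
      intro u hu'
      have hu : u ∈ Set.Ioc (0:ℝ) T := ⟨hu'.1, hu'.2.le⟩
      have hu0 := hu.1
      apply ENNReal.ofReal_le_ofReal
      obtain ⟨i1, e1⟩ := aux_int a β u ha hβ hβ2 hu.1
      have hI : ‖∫ s in Set.Ioo (0:ℝ) u,
          (u ^ (-a) * φ u - s ^ (-a) * φ s) * (u - s) ^ (-(1 + a))‖ ≤
          (L + B * u ^ (-β)) * (C * u ^ (β - 2 * a)) := by
        rw [hC, ← e1, ← integral_const_mul]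
        exact norm_integral_le_of_norm_le (i1.const_mul _)
          ((ae_restrict_iff' measurableSet_Ioo).2 (Filter.Eventually.of_forall (hpt u hu)))
      have hGu : |G u| ≤ D * u ^ (-a) := by
        rw [hG u hu]
        refine (abs_add_le _ _).trans ?_
        have hua := Real.rpow_pos_of_pos hu0 a
        have hua' := Real.rpow_pos_of_pos hu0 (-a)
        rw [abs_mul, abs_mul (a * u ^ a), abs_of_pos hua', abs_of_pos (mul_pos ha hua)]
        have j1 := mul_le_mul_of_nonneg_left (hB u ⟨hu.1.le, hu.2⟩) hua'.le
        have j2 := mul_le_mul_of_nonneg_left hI (mul_pos ha hua).le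
        rw [Real.norm_eq_abs] at j2
        have k1 : u ^ a * u ^ (β - 2 * a) = u ^ (-a) * u ^ β := by
          rw [← Real.rpow_add hu0, ← Real.rpow_add hu0]; congr 1; ring
        have k2 : u ^ (-β) * u ^ β = 1 := by
          rw [← Real.rpow_add hu0]; simp
        have k3 : u ^ β ≤ T ^ β := Real.rpow_le_rpow hu0.le hu.2 (by linarith)
        have k4 : a * u ^ a * ((L + B * u ^ (-β)) * (C * u ^ (β - 2 * a))) =
            a * C * (L * u ^ β + B) * u ^ (-a) := by
          calc _ = a * C * (L + B * u ^ (-β)) * (u ^ a * u ^ (β - 2 * a)) := by ring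
            _ = a * C * (L * u ^ β + B * (u ^ (-β) * u ^ β)) * u ^ (-a) := by rw [k1]; ring
            _ = _ := by rw [k2, mul_one]
        have k5 : a * C * (L * u ^ β + B) * u ^ (-a) ≤ a * C * (L * T ^ β + B) * u ^ (-a) := by
          gcongr
        rw [hD]
        linarith
      have e : u ^ (-2 * a) = (u ^ (-a)) ^ 2 := by
        rw [← Real.rpow_natCast, ← Real.rpow_mul hu0.le]; congr 1; push_cast; ring
      rw [e, ← mul_pow, ← sq_abs (G u)]
      exact pow_le_pow_left₀ (abs_nonneg _) hGu 2
    refine (setLIntegral_mono' measurableSet_Ioo hbound).trans_lt ?_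
    have := ((aux_J1 T (-2 * a) hT (by linarith)).1.const_mul (D ^ 2)).lintegral_lt_top
    exact this

/-- For `φ = f·v` with `f` bounded `α₀`-Hölder (`α₀ ∈ (H-1/2,1]`) and `v` bounded
`1/2`-Hölder on `[0,T]`, the weighted Riemann–Liouville fractional derivative
`G(u) = u^{1/2-H} φ(u) + (H-1/2) u^{H-1/2} ∫_0^u (u^{1/2-H}φ(u) - s^{1/2-H}φ(s))(u-s)^{-(H+1/2)} ds`
has an integrable inner integrand for every `u ∈ (0,T]`, and `∫_0^T G(u)² du < ∞`. -/
theorem stmt_9 (H T K Mf M Mv α₀ : ℝ) (hH : H ∈ Set.Ioo (1/2 : ℝ) 1) (hT : 0 < T)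
    (hK : 0 ≤ K) (hM : 0 ≤ M) (hα : α₀ ∈ Set.Ioc (H - 1/2) 1)
    (f v φ : ℝ → ℝ)
    (hfbd : ∀ t ∈ Set.Icc (0:ℝ) T, |f t| ≤ Mf)
    (hf : ∀ s ∈ Set.Icc (0:ℝ) T, ∀ t ∈ Set.Icc (0:ℝ) T, |f t - f s| ≤ K * |t - s| ^ α₀)
    (hvbd : ∀ t ∈ Set.Icc (0:ℝ) T, |v t| ≤ Mv)
    (hv : ∀ s ∈ Set.Icc (0:ℝ) T, ∀ t ∈ Set.Icc (0:ℝ) T, |v t - v s| ≤ M * |t - s| ^ (1/2 : ℝ))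
    (hφ : ∀ s : ℝ, φ s = f s * v s)
    (G : ℝ → ℝ)
    (hG : ∀ u ∈ Set.Ioc (0:ℝ) T,
      G u = u ^ (1/2 - H) * φ u + (H - 1/2) * u ^ (H - 1/2) *
        ∫ s in Set.Ioo (0:ℝ) u,
          (u ^ (1/2 - H) * φ u - s ^ (1/2 - H) * φ s) * (u - s) ^ (-(H + 1/2))) :
    (∀ u ∈ Set.Ioc (0:ℝ) T,
      IntegrableOn
        (fun s : ℝ => (u ^ (1/2 - H) * φ u - s ^ (1/2 - H) * φ s) * (u - s) ^ (-(H + 1/2)))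
        (Set.Ioo 0 u)) ∧
    (∫⁻ u in Set.Ioo (0:ℝ) T, ENNReal.ofReal ((G u) ^ 2)) < ⊤ := by

  obtain ⟨hH1, hH2⟩ := hH
  obtain ⟨hα1, hα2⟩ := hα
  have hMf : 0 ≤ Mf := (abs_nonneg _).trans (hfbd 0 ⟨le_rfl, hT.le⟩)
  have hMv : 0 ≤ Mv := (abs_nonneg _).trans (hvbd 0 ⟨le_rfl, hT.le⟩)
  have hdom : ∀ p q d : ℝ, 0 < q → q ≤ p → 0 ≤ d → d ≤ T → d ^ p ≤ T ^ (p - q) * d ^ q := by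
    intro p q d hq hqp hd hdT
    rcases hd.eq_or_lt with h | h
    · subst h
      rw [Real.zero_rpow (by linarith), Real.zero_rpow (by linarith), mul_zero]
    · have e : d ^ p = d ^ (p - q) * d ^ q := by
        rw [← Real.rpow_add h]; congr 1; ring
      rw [e]
      exact mul_le_mul_of_nonneg_right (Real.rpow_le_rpow hd hdT (by linarith))
        (Real.rpow_nonneg hd _)
  set β := min α₀ (1 / 2) with hβ
  have hβ1 : H - 1 / 2 < β := lt_min hα1 (by linarith)
  have hβα : β ≤ α₀ := min_le_left _ _
  have hβ2 : β ≤ 1 / 2 := min_le_right _ _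
  have e1 : (1 / 2 - H) = -(H - 1 / 2) := by ring
  have e2 : H + 1 / 2 = 1 + (H - 1 / 2) := by ring
  rw [e1, e2]
  simp only [e1, e2] at hG
  refine aux_main (H - 1 / 2) β T (K * T ^ (α₀ - β) * Mv + Mf * (M * T ^ (1 / 2 - β))) (Mf * Mv)
    (by linarith) hβ1 hβ2 (by linarith) hT (by positivity) φ G ?_ ?_ hG
  · intro t ht
    rw [hφ, abs_mul]
    exact mul_le_mul (hfbd t ht) (hvbd t ht) (abs_nonneg _) hMf
  · intro s hs t ht
    have hd : |t - s| ≤ T := abs_le.2 ⟨by linarith [hs.2, ht.1], by linarith [hs.1, ht.2]⟩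
    have d1 := hdom α₀ β _ (by linarith) hβα (abs_nonneg (t - s)) hd
    have d2 := hdom (1 / 2) β _ (by linarith) hβ2 (abs_nonneg (t - s)) hd
    have f1 := (hf s hs t ht).trans (mul_le_mul_of_nonneg_left d1 hK)
    have f2 := (hv s hs t ht).trans (mul_le_mul_of_nonneg_left d2 hM)
    rw [hφ, hφ, show f t * v t - f s * v s = (f t - f s) * v t + f s * (v t - v s) by ring]
    refine (abs_add_le _ _).trans ?_
    rw [abs_mul, abs_mul]
    have g1 := mul_le_mul f1 (hvbd t ht) (abs_nonneg _) (by positivity)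
    have g2 := mul_le_mul (hfbd s hs) f2 (abs_nonneg _) hMf
    linarith
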